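/- arXiv:2212.05694 — 3 statements merged into one kernel-verified Lean document; each statement's English description precedes it below -/
import Mathlib

section
/- For all real a, b > 0, if M is the common limit of the AGM sequences started from (a, b), then K(|a − b|/(a + b)) = (a + b)π/(4M), where K is the complete elliptic integral of the first kind. -/
open Real Filter Topology

/-- The AGM iteration: `agmSeq a b i = (uᵢ, vᵢ)` with `u₀ = a`, `v₀ = b`,
`u_{i+1} = (uᵢ+vᵢ)/2`, `v_{i+1} = √(uᵢ vᵢ)`. -/
noncomputable def agmSeq (a b : ℝ) : ℕ → ℝ × ℝ
  | 0 => (a, b)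
  | i + 1 => (((agmSeq a b i).1 + (agmSeq a b i).2) / 2,
      Real.sqrt ((agmSeq a b i).1 * (agmSeq a b i).2))

/-- The complete elliptic integral of the first kind. -/
noncomputable def K (k : ℝ) : ℝ :=
  ∫ u in (0:ℝ)..(π/2), (1 - k^2 * Real.sin u ^ 2) ^ (-(1/2) : ℝ)

/-- The ratio of double factorials (2j-1)!!/(2j)!!. -/
noncomputable def dfr (j : ℕ) : ℝ :=
  (Nat.doubleFactorial (2*j - 1) : ℝ) / (Nat.doubleFactorial (2*j) : ℝ)

/-- The quadratic form `a² cos² θ + b² sin² θ` appearing in Gauss's integral. -/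
noncomputable def gaussForm (a b θ : ℝ) : ℝ := a ^ 2 * cos θ ^ 2 + b ^ 2 * sin θ ^ 2

/-- Gauss's integral `∫₀^{π/2} (a² cos² θ + b² sin² θ)^{-1/2} dθ`. -/
noncomputable def gaussIntegral (a b : ℝ) : ℝ :=
  ∫ θ in (0:ℝ)..(π / 2), (√(gaussForm a b θ))⁻¹

theorem mul_cos_sq_add_mul_sin_sq_pos {a b : ℝ} (ha : 0 < a) (hb : 0 < b) (θ : ℝ) :
    0 < a * cos θ ^ 2 + b * sin θ ^ 2 := by
  have h : min a b ≤ a * cos θ ^ 2 + b * sin θ ^ 2 := by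
    have h₁ := mul_le_mul_of_nonneg_right (min_le_left a b) (sq_nonneg (cos θ))
    have h₂ := mul_le_mul_of_nonneg_right (min_le_right a b) (sq_nonneg (sin θ))
    linear_combination h₁ + h₂ - min a b * sin_sq_add_cos_sq θ
  exact (lt_min ha hb).trans_le h

theorem gaussForm_pos {a b : ℝ} (ha : 0 < a) (hb : 0 < b) (θ : ℝ) : 0 < gaussForm a b θ :=
  mul_cos_sq_add_mul_sin_sq_pos (pow_pos ha 2) (pow_pos hb 2) θ

theorem continuous_inv_sqrt_gaussForm {a b : ℝ} (ha : 0 < a) (hb : 0 < b) :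
    Continuous fun θ => (√(gaussForm a b θ))⁻¹ := by
  refine Continuous.inv₀ ?_ fun θ => (sqrt_pos.2 (gaussForm_pos ha hb θ)).ne'
  unfold gaussForm
  fun_prop

theorem le_sqrt_gaussForm {a b m : ℝ} (hm : 0 ≤ m) (ha : m ≤ a) (hb : m ≤ b) (θ : ℝ) :
    m ≤ √(gaussForm a b θ) := by
  refine le_sqrt_of_sq_le ?_
  have h₁ : m ^ 2 * cos θ ^ 2 ≤ a ^ 2 * cos θ ^ 2 := by gcongr
  have h₂ : m ^ 2 * sin θ ^ 2 ≤ b ^ 2 * sin θ ^ 2 := by gcongr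
  unfold gaussForm
  linear_combination h₁ + h₂ - m ^ 2 * sin_sq_add_cos_sq θ

theorem sqrt_gaussForm_le {a b m : ℝ} (ha₀ : 0 ≤ a) (hb₀ : 0 ≤ b) (ha : a ≤ m) (hb : b ≤ m)
    (θ : ℝ) : √(gaussForm a b θ) ≤ m := by
  refine sqrt_le_iff.2 ⟨ha₀.trans ha, ?_⟩
  have h₁ : a ^ 2 * cos θ ^ 2 ≤ m ^ 2 * cos θ ^ 2 := by gcongr
  have h₂ : b ^ 2 * sin θ ^ 2 ≤ m ^ 2 * sin θ ^ 2 := by gcongr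
  unfold gaussForm
  linear_combination h₁ + h₂ + m ^ 2 * sin_sq_add_cos_sq θ

theorem gaussIntegral_le {a b : ℝ} (ha : 0 < a) (hb : 0 < b) :
    gaussIntegral a b ≤ π / 2 * (min a b)⁻¹ := by
  have hm := lt_min ha hb
  have h := intervalIntegral.integral_mono_on (a := 0) (b := π / 2) (by positivity)
    ((continuous_inv_sqrt_gaussForm ha hb).intervalIntegrable _ _)
    (continuous_const.intervalIntegrable (μ := MeasureTheory.volume) _ _)
    fun θ _ => inv_anti₀ hm (le_sqrt_gaussForm hm.le (min_le_left a b) (min_le_right a b) θ)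
  simpa [gaussIntegral] using h

theorem le_gaussIntegral {a b : ℝ} (ha : 0 < a) (hb : 0 < b) :
    π / 2 * (max a b)⁻¹ ≤ gaussIntegral a b := by
  have h := intervalIntegral.integral_mono_on (a := 0) (b := π / 2) (by positivity)
    (continuous_const.intervalIntegrable (μ := MeasureTheory.volume) _ _)
    ((continuous_inv_sqrt_gaussForm ha hb).intervalIntegrable _ _)
    fun θ _ => inv_anti₀ (sqrt_pos.2 (gaussForm_pos ha hb θ))
      (sqrt_gaussForm_le ha.le hb.le (le_max_left a b) (le_max_right a b) θ)
  simpa [gaussIntegral] using h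

theorem integral_zero_pi_inv_sqrt_gaussForm {a b : ℝ} (ha : 0 < a) (hb : 0 < b) :
    ∫ θ in (0:ℝ)..π, (√(gaussForm a b θ))⁻¹ = 2 * gaussIntegral a b := by
  have hc := continuous_inv_sqrt_gaussForm ha hb
  have h := intervalIntegral.integral_comp_sub_left (a := 0) (b := π / 2)
    (fun θ => (√(gaussForm a b θ))⁻¹) π
  simp only [gaussForm, cos_pi_sub, sin_pi_sub, neg_sq, sub_zero, sub_half] at h
  rw [← intervalIntegral.integral_add_adjacent_intervals
    (hc.intervalIntegrable 0 (π / 2)) (hc.intervalIntegrable (π / 2) π)]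
  unfold gaussIntegral gaussForm
  rw [← h]
  ring

/-- The Landen change of variables, a smooth form of `θ ↦ θ + arctan ((b / a) * tan θ)`. -/
noncomputable def landen (a b θ : ℝ) : ℝ :=
  2 * θ - arctan ((a - b) * (sin θ * cos θ) / (a * cos θ ^ 2 + b * sin θ ^ 2))

theorem landen_aux {a b : ℝ} (ha : 0 < a) (hb : 0 < b) (θ : ℝ) :
    1 + ((a - b) * (sin θ * cos θ) / (a * cos θ ^ 2 + b * sin θ ^ 2)) ^ 2
      = gaussForm a b θ / (a * cos θ ^ 2 + b * sin θ ^ 2) ^ 2 := by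
  have hq := (mul_cos_sq_add_mul_sin_sq_pos ha hb θ).ne'
  rw [div_pow, eq_div_iff (pow_ne_zero 2 hq), add_mul, div_mul_cancel₀ _ (pow_ne_zero 2 hq)]
  unfold gaussForm
  linear_combination (a ^ 2 * cos θ ^ 2 + b ^ 2 * sin θ ^ 2) * sin_sq_add_cos_sq θ

theorem hasDerivAt_landen {a b : ℝ} (ha : 0 < a) (hb : 0 < b) (θ : ℝ) :
    HasDerivAt (landen a b)
      ((a + b) * (a * cos θ ^ 2 + b * sin θ ^ 2) / gaussForm a b θ) θ := by
  have hq := (mul_cos_sq_add_mul_sin_sq_pos ha hb θ).ne'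
  have hD := (gaussForm_pos ha hb θ).ne'
  have hnum := ((hasDerivAt_sin θ).mul (hasDerivAt_cos θ)).const_mul (a - b)
  have hden := (((hasDerivAt_cos θ).pow 2).const_mul a).add
    (((hasDerivAt_sin θ).pow 2).const_mul b)
  have h := ((hasDerivAt_id θ).const_mul 2).sub ((hnum.div hden hq).arctan)
  refine h.congr_deriv ?_
  simp only [Pi.mul_apply, Pi.add_apply, Pi.pow_apply, Pi.div_apply]
  rw [landen_aux ha hb θ]
  field_simp
  unfold gaussForm
  push_cast
  linear_combination -(a - b) * (a * cos θ ^ 2 - b * sin θ ^ 2) * sin_sq_add_cos_sq θ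

theorem gaussForm_landen {a b : ℝ} (ha : 0 < a) (hb : 0 < b) (θ : ℝ) :
    gaussForm ((a + b) / 2) (√(a * b)) (landen a b θ)
      = ((a + b) / 2 * (a * cos θ ^ 2 + b * sin θ ^ 2)) ^ 2 / gaussForm a b θ := by
  have hq := mul_cos_sq_add_mul_sin_sq_pos ha hb θ
  have hD := gaussForm_pos ha hb θ
  have hs := sqrt_pos.2 hD
  have hsq := sq_sqrt hD.le
  have hroot : √(1 + ((a - b) * (sin θ * cos θ) / (a * cos θ ^ 2 + b * sin θ ^ 2)) ^ 2)
      = √(gaussForm a b θ) / (a * cos θ ^ 2 + b * sin θ ^ 2) := by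
    rw [landen_aux ha hb θ, sqrt_div hD.le, sqrt_sq hq.le]
  have hcos : cos (landen a b θ) = (a * cos θ ^ 2 - b * sin θ ^ 2) / √(gaussForm a b θ) := by
    rw [landen, cos_sub, cos_arctan, sin_arctan, hroot, cos_two_mul', sin_two_mul]
    generalize hq_def : a * cos θ ^ 2 + b * sin θ ^ 2 = q at hq ⊢
    field_simp
    rw [← hq_def]
    linear_combination (a * cos θ ^ 2 - b * sin θ ^ 2) * sin_sq_add_cos_sq θ
  have hsin : sin (landen a b θ) = (a + b) * (sin θ * cos θ) / √(gaussForm a b θ) := by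
    rw [landen, sin_sub, cos_arctan, sin_arctan, hroot, cos_two_mul', sin_two_mul]
    generalize hq_def : a * cos θ ^ 2 + b * sin θ ^ 2 = q at hq ⊢
    field_simp
    rw [← hq_def]
    linear_combination (a + b) * sin θ * cos θ * sin_sq_add_cos_sq θ
  rw [gaussForm, hcos, hsin, sq_sqrt (mul_pos ha hb).le]
  simp only [div_pow, hsq]
  ring

/-- Invariance of Gauss's integral under the arithmetic-geometric mean step. -/
theorem gaussIntegral_agm_step {a b : ℝ} (ha : 0 < a) (hb : 0 < b) :
    gaussIntegral ((a + b) / 2) √(a * b) = gaussIntegral a b := by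
  have hA : 0 < (a + b) / 2 := by positivity
  have hG : 0 < √(a * b) := by positivity
  have hcont : Continuous fun θ => (a + b) * (a * cos θ ^ 2 + b * sin θ ^ 2) / gaussForm a b θ := by
    refine Continuous.div (by fun_prop) ?_ fun θ => (gaussForm_pos ha hb θ).ne'
    unfold gaussForm
    fun_prop
  have h := intervalIntegral.integral_comp_mul_deriv (a := 0) (b := π / 2)
    (fun θ _ => hasDerivAt_landen ha hb θ) hcont.continuousOn
    (continuous_inv_sqrt_gaussForm hA hG)
  have h₀ : landen a b 0 = 0 := by simp [landen]
  have h₁ : landen a b (π / 2) = π := by simp [landen]; ring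
  rw [h₀, h₁, integral_zero_pi_inv_sqrt_gaussForm hA hG] at h
  have hpt : ∀ θ, ((fun θ => (√(gaussForm ((a + b) / 2) √(a * b) θ))⁻¹) ∘ landen a b) θ *
      ((a + b) * (a * cos θ ^ 2 + b * sin θ ^ 2) / gaussForm a b θ)
      = 2 * (√(gaussForm a b θ))⁻¹ := by
    intro θ
    have hq := mul_cos_sq_add_mul_sin_sq_pos ha hb θ
    have hD := gaussForm_pos ha hb θ
    have hs := sqrt_pos.2 hD
    have hsq := sq_sqrt hD.le
    rw [Function.comp_apply, gaussForm_landen ha hb, sqrt_div (sq_nonneg _),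
      sqrt_sq (mul_pos hA hq).le]
    nth_rewrite 2 [← hsq]
    field_simp
  simp_rw [hpt] at h
  rw [intervalIntegral.integral_const_mul] at h
  exact (mul_left_cancel₀ two_ne_zero h).symm

theorem agmSeq_ge_min {a b : ℝ} (ha : 0 < a) (hb : 0 < b) (i : ℕ) :
    min a b ≤ (agmSeq a b i).1 ∧ min a b ≤ (agmSeq a b i).2 := by
  have hm := lt_min ha hb
  induction i with
  | zero => exact ⟨min_le_left a b, min_le_right a b⟩
  | succ i ih =>
    refine ⟨?_, le_sqrt_of_sq_le ?_⟩
    · simp only [agmSeq]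
      linarith [ih.1, ih.2]
    · rw [sq]
      exact mul_le_mul ih.1 ih.2 hm.le (hm.le.trans ih.1)

theorem gaussIntegral_agmSeq {a b : ℝ} (ha : 0 < a) (hb : 0 < b) (i : ℕ) :
    gaussIntegral (agmSeq a b i).1 (agmSeq a b i).2 = gaussIntegral a b := by
  induction i with
  | zero => rfl
  | succ i ih =>
    have h := agmSeq_ge_min ha hb i
    have hm := lt_min ha hb
    exact (gaussIntegral_agm_step (hm.trans_le h.1) (hm.trans_le h.2)).trans ih

/-- Gauss's formula for the arithmetic-geometric mean. -/
theorem gaussIntegral_eq_of_tendsto_agmSeq {a b M : ℝ} (ha : 0 < a) (hb : 0 < b)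
    (hu : Tendsto (fun i => (agmSeq a b i).1) atTop (𝓝 M))
    (hv : Tendsto (fun i => (agmSeq a b i).2) atTop (𝓝 M)) :
    gaussIntegral a b = π / 2 * M⁻¹ := by
  have hm := lt_min ha hb
  have hM : M ≠ 0 :=
    (hm.trans_le (ge_of_tendsto' hu fun i => (agmSeq_ge_min ha hb i).1)).ne'
  have hmin := hu.min hv
  have hmax := hu.max hv
  rw [min_self] at hmin
  rw [max_self] at hmax
  have hpos i : 0 < (agmSeq a b i).1 ∧ 0 < (agmSeq a b i).2 :=
    ⟨hm.trans_le (agmSeq_ge_min ha hb i).1, hm.trans_le (agmSeq_ge_min ha hb i).2⟩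
  refine le_antisymm (ge_of_tendsto' ((hmin.inv₀ hM).const_mul (π / 2)) fun i => ?_)
    (le_of_tendsto' ((hmax.inv₀ hM).const_mul (π / 2)) fun i => ?_)
  · rw [← gaussIntegral_agmSeq ha hb i]
    exact gaussIntegral_le (hpos i).1 (hpos i).2
  · rw [← gaussIntegral_agmSeq ha hb i]
    exact le_gaussIntegral (hpos i).1 (hpos i).2

theorem K_eq_mul_gaussIntegral {a b : ℝ} (ha : 0 < a) (hb : 0 < b) :
    K (|a - b| / (a + b)) = (a + b) / 2 * gaussIntegral ((a + b) / 2) √(a * b) := by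
  have hA : 0 < (a + b) / 2 := by positivity
  have hG : 0 < √(a * b) := by positivity
  rw [K, gaussIntegral, ← intervalIntegral.integral_const_mul]
  refine intervalIntegral.integral_congr fun θ _ => ?_
  have hD := gaussForm_pos hA hG θ
  have h : 1 - (|a - b| / (a + b)) ^ 2 * sin θ ^ 2
      = gaussForm ((a + b) / 2) √(a * b) θ / ((a + b) / 2) ^ 2 := by
    rw [gaussForm, sq_sqrt (mul_pos ha hb).le, div_pow, sq_abs, cos_sq']
    field_simp
    ring
  rw [h, rpow_neg (by positivity), ← sqrt_eq_rpow, sqrt_div hD.le, sqrt_sq hA.le, inv_div,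
    div_eq_mul_inv]

theorem agm_and_cei1 (a b : ℝ) (ha : 0 < a) (hb : 0 < b) (M : ℝ)
    (hu : Tendsto (fun i => (agmSeq a b i).1) atTop (𝓝 M))
    (hv : Tendsto (fun i => (agmSeq a b i).2) atTop (𝓝 M)) :
    K (|a - b| / (a + b)) = (a + b) * π / (4 * M) := by
  rw [K_eq_mul_gaussIntegral ha hb, gaussIntegral_agm_step ha hb,
    gaussIntegral_eq_of_tendsto_agmSeq ha hb hu hv]
  ring
end

section
/- For every real k with 0 ≤ k < 1, if M is the common limit of the AGM sequences started from (1 + k, 1 − k), then K(k) = (π/2)/M. -/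
open Real Filter Topology

/-- The algebraic form of the complete elliptic integral attached to a pair `(a, b)`. -/
noncomputable def ellipticIntegral (a b : ℝ) : ℝ :=
  ∫ t in Set.Ioi (0:ℝ), (√((a ^ 2 + t ^ 2) * (b ^ 2 + t ^ 2)))⁻¹

theorem image_mul_tan_Ioo {b : ℝ} (hb : 0 < b) :
    (fun x => b * tan x) '' Set.Ioo 0 (π / 2) = Set.Ioi 0 := by
  ext y
  constructor
  · rintro ⟨x, hx, rfl⟩
    exact mul_pos hb (tan_pos_of_pos_of_lt_pi_div_two hx.1 hx.2)
  · intro hy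
    refine ⟨arctan (y / b), ⟨arctan_pos.2 (div_pos hy hb), arctan_lt_pi_div_two _⟩, ?_⟩
    simp only [tan_arctan]
    field_simp

theorem ellipticIntegral_eq_trig (a : ℝ) {b : ℝ} (hb : 0 < b) :
    ellipticIntegral a b =
      ∫ x in (0:ℝ)..(π / 2), (√(a ^ 2 * cos x ^ 2 + b ^ 2 * sin x ^ 2))⁻¹ := by
  have hcos : ∀ x ∈ Set.Ioo 0 (π / 2), 0 < cos x := fun x hx =>
    cos_pos_of_mem_Ioo ⟨by linarith [hx.1, pi_pos], hx.2⟩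
  have hderiv : ∀ x ∈ Set.Ioo 0 (π / 2),
      HasDerivWithinAt (fun x => b * tan x) (b * (1 / cos x ^ 2)) (Set.Ioo 0 (π / 2)) x :=
    fun x hx => ((hasDerivAt_tan (hcos x hx).ne').const_mul b).hasDerivWithinAt
  have hinj : Set.InjOn (fun x => b * tan x) (Set.Ioo 0 (π / 2)) := by
    intro x hx y hy h
    exact tan_inj_of_lt_of_lt_pi_div_two (by linarith [hx.1, pi_pos]) hx.2
      (by linarith [hy.1, pi_pos]) hy.2 (mul_left_cancel₀ hb.ne' h)
  rw [ellipticIntegral, ← image_mul_tan_Ioo hb,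
    MeasureTheory.integral_image_eq_integral_abs_deriv_smul measurableSet_Ioo hderiv hinj,
    intervalIntegral.integral_of_le (by positivity), MeasureTheory.integral_Ioc_eq_integral_Ioo]
  refine MeasureTheory.setIntegral_congr_fun measurableSet_Ioo fun x hx => ?_
  have hc := hcos x hx
  have key : (a ^ 2 + (b * tan x) ^ 2) * (b ^ 2 + (b * tan x) ^ 2) =
      (b * (1 / cos x ^ 2)) ^ 2 * (a ^ 2 * cos x ^ 2 + b ^ 2 * sin x ^ 2) := by
    rw [tan_eq_sin_div_cos]
    field_simp
    rw [cos_sq_add_sin_sq, mul_one]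
  have hpos : 0 < b * (1 / cos x ^ 2) := by positivity
  simp only [smul_eq_mul]
  rw [key, sqrt_mul (sq_nonneg _), sqrt_sq hpos.le, abs_of_pos hpos, mul_inv,
    mul_inv_cancel_left₀ hpos.ne']

theorem strictMonoOn_sub_div {c : ℝ} (hc : 0 < c) :
    StrictMonoOn (fun t : ℝ => (t - c / t) / 2) (Set.Ioi 0) := by
  intro x hx y _ hxy
  have := div_lt_div_of_pos_left hc hx hxy
  simp only
  linarith

theorem image_sub_div_Ioi {c : ℝ} (hc : 0 < c) :
    (fun t : ℝ => (t - c / t) / 2) '' Set.Ioi 0 = Set.univ := by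
  refine Set.eq_univ_of_forall fun y => ?_
  have hlt : |y| < √(y ^ 2 + c) := lt_sqrt_of_sq_lt (by rw [sq_abs]; linarith)
  have hpos : 0 < y + √(y ^ 2 + c) := by linarith [neg_abs_le y]
  refine ⟨y + √(y ^ 2 + c), hpos, ?_⟩
  have hs : √(y ^ 2 + c) ^ 2 = y ^ 2 + c := sq_sqrt (by positivity)
  simp only
  field_simp
  nlinarith

/-- Gauss invariance of the elliptic integral under one AGM step. -/
theorem ellipticIntegral_agm_step {a b : ℝ} (ha : 0 < a) (hb : 0 < b) :
    ellipticIntegral ((a + b) / 2) √(a * b) = ellipticIntegral a b := by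
  have hc : 0 < a * b := mul_pos ha hb
  have hderiv : ∀ t ∈ Set.Ioi (0:ℝ), HasDerivWithinAt (fun t : ℝ => (t - a * b / t) / 2)
      ((1 + a * b / t ^ 2) / 2) (Set.Ioi 0) t := by
    intro t ht
    have h := ((hasDerivAt_id t).sub ((hasDerivAt_inv (ne_of_gt ht)).const_mul (a * b))).div_const 2
    refine (h.congr_deriv ?_).hasDerivWithinAt
    ring
  have hsymm := integral_comp_abs
    (f := fun t : ℝ => (√((((a + b) / 2) ^ 2 + t ^ 2) * (√(a * b) ^ 2 + t ^ 2)))⁻¹)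
  simp only [sq_abs] at hsymm
  suffices h : ∫ t : ℝ, (√((((a + b) / 2) ^ 2 + t ^ 2) * (√(a * b) ^ 2 + t ^ 2)))⁻¹ =
      2 * ellipticIntegral a b by
    rw [hsymm] at h
    exact mul_left_cancel₀ two_ne_zero h
  rw [← MeasureTheory.setIntegral_univ, ← image_sub_div_Ioi hc,
    MeasureTheory.integral_image_eq_integral_abs_deriv_smul measurableSet_Ioi hderiv
      (strictMonoOn_sub_div hc).injOn, ellipticIntegral, ← MeasureTheory.integral_const_mul]
  refine MeasureTheory.setIntegral_congr_fun measurableSet_Ioi fun t ht => ?_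
  have ht : 0 < t := ht
  have key : (((a + b) / 2) ^ 2 + ((t - a * b / t) / 2) ^ 2) *
      (√(a * b) ^ 2 + ((t - a * b / t) / 2) ^ 2) =
      ((1 + a * b / t ^ 2) / 2 / 2) ^ 2 * ((a ^ 2 + t ^ 2) * (b ^ 2 + t ^ 2)) := by
    rw [sq_sqrt hc.le]
    field_simp
    ring
  have hpos : 0 < (1 + a * b / t ^ 2) / 2 := by positivity
  simp only [smul_eq_mul]
  rw [key, sqrt_mul (sq_nonneg _), sqrt_sq (by positivity), abs_of_pos hpos, mul_inv, inv_div,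
    ← mul_assoc, mul_div_cancel₀ _ hpos.ne']

theorem ellipticIntegral_mem_Icc {a b : ℝ} (hb : 0 < b) (hba : b ≤ a) :
    ellipticIntegral a b ∈ Set.Icc (π / 2 / a) (π / 2 / b) := by
  have ha : 0 < a := hb.trans_le hba
  have hsq : b ^ 2 ≤ a ^ 2 := by gcongr
  have hlow : ∀ x, b ^ 2 ≤ a ^ 2 * cos x ^ 2 + b ^ 2 * sin x ^ 2 := fun x => by
    nlinarith [sin_sq_add_cos_sq x, mul_le_mul_of_nonneg_right hsq (sq_nonneg (cos x))]
  have hupp : ∀ x, a ^ 2 * cos x ^ 2 + b ^ 2 * sin x ^ 2 ≤ a ^ 2 := fun x => by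
    nlinarith [sin_sq_add_cos_sq x, mul_le_mul_of_nonneg_right hsq (sq_nonneg (sin x))]
  have hb_le : ∀ x, b ≤ √(a ^ 2 * cos x ^ 2 + b ^ 2 * sin x ^ 2) := fun x =>
    le_sqrt_of_sq_le (hlow x)
  have hint : IntervalIntegrable
      (fun x => (√(a ^ 2 * cos x ^ 2 + b ^ 2 * sin x ^ 2))⁻¹) MeasureTheory.volume 0 (π / 2) :=
    (Continuous.inv₀ (by fun_prop) fun x => (hb.trans_le (hb_le x)).ne').intervalIntegrable _ _
  have hconst : ∀ c : ℝ, π / 2 / c = ∫ _ in (0:ℝ)..(π / 2), c⁻¹ := fun c => by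
    simp [div_eq_mul_inv]
  rw [ellipticIntegral_eq_trig a hb, hconst a, hconst b]
  constructor
  · refine intervalIntegral.integral_mono (by positivity) (by simp) hint fun x => ?_
    exact inv_anti₀ (hb.trans_le (hb_le x)) ((sqrt_le_left ha.le).2 (hupp x))
  · exact intervalIntegral.integral_mono (by positivity) hint (by simp)
      fun x => inv_anti₀ hb (hb_le x)

theorem agmSeq_bounds {a b : ℝ} (hb : 0 < b) (hba : b ≤ a) (i : ℕ) :
    b ≤ (agmSeq a b i).2 ∧ (agmSeq a b i).2 ≤ (agmSeq a b i).1 := by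
  induction i with
  | zero => exact ⟨le_rfl, hba⟩
  | succ i ih =>
    obtain ⟨h₁, h₂⟩ := ih
    simp only [agmSeq]
    constructor
    · exact le_sqrt_of_sq_le (by nlinarith)
    · rw [sqrt_le_left (by linarith)]
      nlinarith [sq_nonneg ((agmSeq a b i).1 - (agmSeq a b i).2)]

theorem ellipticIntegral_agmSeq {a b : ℝ} (hb : 0 < b) (hba : b ≤ a) (i : ℕ) :
    ellipticIntegral (agmSeq a b i).1 (agmSeq a b i).2 = ellipticIntegral a b := by
  induction i with
  | zero => rfl
  | succ i ih =>
    obtain ⟨h₁, h₂⟩ := agmSeq_bounds hb hba i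
    rw [← ih]
    exact ellipticIntegral_agm_step (by linarith) (by linarith)

/-- Theorem of Gauss: the elliptic integral of `(a, b)` is `π / 2` over the AGM of `a` and `b`. -/
theorem ellipticIntegral_eq_of_tendsto {a b M : ℝ} (hb : 0 < b) (hba : b ≤ a)
    (hu : Tendsto (fun i => (agmSeq a b i).1) atTop (𝓝 M))
    (hv : Tendsto (fun i => (agmSeq a b i).2) atTop (𝓝 M)) :
    ellipticIntegral a b = π / 2 / M := by
  have hM : M ≠ 0 :=
    (hb.trans_le (ge_of_tendsto' hv fun i => (agmSeq_bounds hb hba i).1)).ne'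
  have hmem : ∀ i, ellipticIntegral a b ∈
      Set.Icc (π / 2 / (agmSeq a b i).1) (π / 2 / (agmSeq a b i).2) := fun i => by
    obtain ⟨h₁, h₂⟩ := agmSeq_bounds hb hba i
    rw [← ellipticIntegral_agmSeq hb hba i]
    exact ellipticIntegral_mem_Icc (hb.trans_le h₁) h₂
  exact le_antisymm
    (ge_of_tendsto' (tendsto_const_nhds.div hv hM) fun i => (hmem i).2)
    (le_of_tendsto' (tendsto_const_nhds.div hu hM) fun i => (hmem i).1)

theorem K_eq_ellipticIntegral {k : ℝ} (hk : 0 < 1 - k ^ 2) :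
    K k = ellipticIntegral 1 √(1 - k ^ 2) := by
  rw [ellipticIntegral_eq_trig 1 (sqrt_pos.2 hk), K]
  refine intervalIntegral.integral_congr fun x _ => ?_
  have heq : 1 ^ 2 * cos x ^ 2 + √(1 - k ^ 2) ^ 2 * sin x ^ 2 = 1 - k ^ 2 * sin x ^ 2 := by
    rw [sq_sqrt hk.le, cos_sq']
    ring
  have hnonneg : 0 ≤ 1 - k ^ 2 * sin x ^ 2 := heq ▸ by positivity
  rw [heq, rpow_neg hnonneg, sqrt_eq_rpow]

theorem cei1_agm_one_add (k : ℝ) (hk0 : 0 ≤ k) (hk1 : k < 1) (M : ℝ)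
    (hu : Tendsto (fun i => (agmSeq (1+k) (1-k) i).1) atTop (𝓝 M))
    (hv : Tendsto (fun i => (agmSeq (1+k) (1-k) i).2) atTop (𝓝 M)) :
    K k = (π/2) / M := by
  have hb : 0 < 1 - k := by linarith
  rw [K_eq_ellipticIntegral (by nlinarith),
    ← ellipticIntegral_eq_of_tendsto hb (by linarith) hu hv,
    ← ellipticIntegral_agm_step (by linarith) hb]
  congr 2 <;> ring
end

section
/- Let n ≥ 1 be a natural number, let a < b be reals, let k ∈ ℝ be a fixed parameter, let Pₙ be the n-th Legendre polynomial with pairwise distinct roots x₁, …, xₙ ∈ (−1, 1), and set wᵢ = 2/((1 − xᵢ²)·Pₙ′(xᵢ)²). Then for every f : ℝ × ℝ → ℝ such that x ↦ f(x, k) is 2n times continuously differentiable on [a, b], there exists ξ ∈ (a, b) such that ∫_{a}^{b} f(x, k) dx = ((b−a)/2) · Σ_{i=1}^{n} wᵢ f((b + a + (b − a)xᵢ)/2, k) + ((n!)⁴/((2n)!)³) · ((b−a)^{2n+1}/(2n+1)) · ∂_x^{(2n)} f(ξ, k). -/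
open Real

/-- The `n`-th Legendre polynomial via the Rodrigues formula. -/
noncomputable def legendre (n : ℕ) (x : ℝ) : ℝ :=
  (1 / (2^n * (Nat.factorial n : ℝ))) * iteratedDeriv n (fun y : ℝ => (y^2 - 1)^n) x

open Polynomial Set

theorem iteratedDeriv_polynomial_eval (p : ℝ[X]) (m : ℕ) :
    iteratedDeriv m (fun y => p.eval y) = fun y => (derivative^[m] p).eval y := by
  induction m with
  | zero => simp
  | succ m ih =>
    rw [iteratedDeriv_succ, ih, Function.iterate_succ_apply']
    ext y
    exact Polynomial.deriv _

/-- The Legendre polynomial as a formal polynomial. -/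
noncomputable def legendrePoly (n : ℕ) : ℝ[X] :=
  C (1 / (2 ^ n * (n.factorial : ℝ))) * derivative^[n] ((X ^ 2 - 1) ^ n)

theorem legendre_eq_eval (n : ℕ) : legendre n = fun y => (legendrePoly n).eval y := by
  ext y
  have h : (fun y : ℝ => (y ^ 2 - 1) ^ n) = fun y => ((X ^ 2 - 1 : ℝ[X]) ^ n).eval y := by
    ext; simp
  rw [legendre, h, iteratedDeriv_polynomial_eval, legendrePoly, eval_mul, eval_C]

theorem intervalIntegrable_eval (p : ℝ[X]) (a b : ℝ) :
    IntervalIntegrable (fun y => p.eval y) MeasureTheory.volume a b :=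
  p.continuous.intervalIntegrable _ _

theorem integral_eval_derivative (p : ℝ[X]) (a b : ℝ) :
    ∫ y in a..b, (derivative p).eval y = p.eval b - p.eval a :=
  intervalIntegral.integral_eq_sub_of_hasDerivAt (fun y _ => p.hasDerivAt y)
    (intervalIntegrable_eval _ _ _)

theorem integral_eval_add (p q : ℝ[X]) (a b : ℝ) :
    ∫ y in a..b, (p + q).eval y = (∫ y in a..b, p.eval y) + ∫ y in a..b, q.eval y := by
  simp only [eval_add]
  exact intervalIntegral.integral_add (intervalIntegrable_eval _ _ _)
    (intervalIntegrable_eval _ _ _)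

theorem integral_eval_C_mul (c : ℝ) (p : ℝ[X]) (a b : ℝ) :
    ∫ y in a..b, (C c * p).eval y = c * ∫ y in a..b, p.eval y := by
  simp [intervalIntegral.integral_const_mul]

theorem eval_iterate_derivative_sq_sub_one_pow_eq_zero {m n : ℕ} (hmn : m < n) {r : ℝ}
    (hr : r ^ 2 = 1) : (derivative^[m] ((X ^ 2 - 1 : ℝ[X]) ^ n)).eval r = 0 := by
  have hdvd : (X ^ 2 - 1 : ℝ[X]) ^ (n - m) ∣ derivative^[m] ((X ^ 2 - 1 : ℝ[X]) ^ n) :=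
    pow_sub_dvd_iterate_derivative_pow _ n m
  refine eval_eq_zero_of_dvd_of_eval_eq_zero hdvd ?_
  simp [hr, Nat.sub_ne_zero_of_lt hmn]

theorem integral_iterate_derivative_mul_eq_zero {m n : ℕ} (hmn : m ≤ n) (q : ℝ[X])
    (hq : q.degree < m) :
    ∫ y in (-1 : ℝ)..1, (derivative^[m] ((X ^ 2 - 1 : ℝ[X]) ^ n) * q).eval y = 0 := by
  induction m generalizing q with
  | zero =>
    have : q = 0 := by simpa [Nat.WithBot.lt_zero_iff] using hq
    simp [this]
  | succ m ih =>
    set D := derivative^[m] ((X ^ 2 - 1 : ℝ[X]) ^ n) with hD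
    have hq' : (derivative q).degree < m := by
      rw [degree_lt_iff_coeff_zero] at hq ⊢
      intro k hk
      rw [coeff_derivative, hq (k + 1) (by omega), zero_mul]
    have hparts := integral_eval_derivative (D * q) (-1) 1
    rw [derivative_mul, integral_eval_add, ih (by omega) _ hq', add_zero, eval_mul, eval_mul,
      hD, eval_iterate_derivative_sq_sub_one_pow_eq_zero hmn (by norm_num),
      eval_iterate_derivative_sq_sub_one_pow_eq_zero hmn (by norm_num)] at hparts
    rw [Function.iterate_succ_apply', hparts]
    simp

theorem integral_legendrePoly_mul_eq_zero {n : ℕ} (q : ℝ[X]) (hq : q.degree < n) :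
    ∫ y in (-1 : ℝ)..1, (legendrePoly n * q).eval y = 0 := by
  rw [legendrePoly, mul_assoc, integral_eval_C_mul,
    integral_iterate_derivative_mul_eq_zero le_rfl q hq, mul_zero]

theorem eval_iterate_derivative_eq_taylor_coeff (p : ℝ[X]) (n : ℕ) (r : ℝ) :
    (derivative^[n] p).eval r = n.factorial * (taylor r p).coeff n := by
  rw [taylor_coeff, ← factorial_smul_hasseDeriv]
  simp

theorem legendrePoly_eval_sq {r : ℝ} (hr : r ^ 2 = 1) (n : ℕ) :
    (legendrePoly n).eval r ^ 2 = 1 := by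
  have h : taylor r ((X ^ 2 - 1 : ℝ[X]) ^ n) = (X + C (2 * r)) ^ n * X ^ n := by
    have h1 : (C r : ℝ[X]) ^ 2 = 1 := by rw [← C_pow, hr, C_1]
    rw [taylor_pow, ← mul_pow]
    congr 1
    simp only [map_sub, taylor_pow, taylor_X, taylor_one, map_mul, C_1, map_ofNat]
    linear_combination h1
  have hc : ((X + C (2 * r) : ℝ[X]) ^ n).coeff 0 = (2 * r) ^ n := by
    simp [coeff_zero_eq_eval_zero]
  have hcoeff := coeff_mul_X_pow ((X + C (2 * r) : ℝ[X]) ^ n) n 0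
  rw [zero_add, hc] at hcoeff
  rw [legendrePoly, eval_mul, eval_C, eval_iterate_derivative_eq_taylor_coeff, h, hcoeff, mul_pow]
  have hf : (n.factorial : ℝ) ≠ 0 := by positivity
  have hr' : (r ^ n) ^ 2 = 1 := by rw [← pow_mul, mul_comm, pow_mul, hr, one_pow]
  field_simp
  rw [mul_pow 2 r n, mul_pow, hr', mul_one]

theorem legendrePoly_coeff_self (n : ℕ) :
    (legendrePoly n).coeff n = (2 * n).factorial / (2 ^ n * (n.factorial : ℝ) ^ 2) := by
  have hm : ((X ^ 2 - 1 : ℝ[X]) ^ n).coeff (n + n) = 1 := by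
    have hmonic : (X ^ 2 - 1 : ℝ[X]).Monic := by
      simpa using monic_X_pow_sub_C (1 : ℝ) two_ne_zero
    have hdeg : (X ^ 2 - 1 : ℝ[X]).natDegree = 2 := by
      simpa using natDegree_X_pow_sub_C (n := 2) (r := (1 : ℝ))
    have := (hmonic.pow n).coeff_natDegree
    rwa [hmonic.natDegree_pow, hdeg, mul_two] at this
  rw [legendrePoly, coeff_C_mul, coeff_iterate_derivative, hm, nsmul_eq_mul, mul_one]
  have hfac := Nat.factorial_mul_descFactorial (Nat.le_add_left n n)
  rw [Nat.add_sub_cancel] at hfac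
  rw [two_mul, ← hfac]
  have hf : (n.factorial : ℝ) ≠ 0 := by positivity
  push_cast
  field_simp

theorem legendrePoly_natDegree (n : ℕ) : (legendrePoly n).natDegree = n := by
  refine natDegree_eq_of_le_of_coeff_ne_zero ?_ ?_
  · refine (natDegree_C_mul_le _ _).trans ((natDegree_iterate_derivative _ _).trans ?_)
    have h : ((X ^ 2 - 1 : ℝ[X]) ^ n).natDegree ≤ n * 2 :=
      natDegree_pow_le_of_le n (by compute_degree)
    omega
  · rw [legendrePoly_coeff_self]
    positivity

theorem legendrePoly_degree (n : ℕ) : (legendrePoly n).degree = n := by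
  have h0 : legendrePoly n ≠ 0 := by
    intro h
    have := legendrePoly_coeff_self n
    rw [h, coeff_zero] at this
    have : (0 : ℝ) < (2 * n).factorial / (2 ^ n * (n.factorial : ℝ) ^ 2) := by positivity
    linarith
  rw [degree_eq_natDegree h0, legendrePoly_natDegree]

theorem integral_legendrePoly_sq (n : ℕ) :
    ∫ y in (-1 : ℝ)..1, (legendrePoly n ^ 2).eval y = 2 / (2 * n + 1) := by
  set P := legendrePoly n with hP
  set r : ℝ[X] := X * derivative P - C (n : ℝ) * P with hr
  have hdeg : r.degree < n := by
    rw [degree_lt_iff_coeff_zero]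
    intro k hk
    have hXc : (X * derivative P).coeff k = k * P.coeff k := by
      cases k with
      | zero => simp
      | succ k => rw [coeff_X_mul, coeff_derivative]; push_cast; ring
    rw [hr, coeff_sub, hXc, coeff_C_mul]
    rcases hk.eq_or_lt with rfl | hlt
    · ring
    · rw [coeff_eq_zero_of_natDegree_lt (by rwa [hP, legendrePoly_natDegree])]; ring
  have horth := integral_legendrePoly_mul_eq_zero r hdeg
  have hid : derivative (X * P ^ 2) = C (2 * (n : ℝ) + 1) * P ^ 2 + C 2 * (P * r) := by
    rw [hr, derivative_mul, derivative_X, derivative_pow]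
    simp only [map_add, map_mul, map_ofNat, C_1, Nat.cast_ofNat]
    ring
  have hint := integral_eval_derivative (X * P ^ 2) (-1) 1
  rw [hid, integral_eval_add, integral_eval_C_mul, integral_eval_C_mul, horth, eval_mul, eval_mul,
    eval_pow, eval_pow, hP, legendrePoly_eval_sq (by norm_num), legendrePoly_eval_sq (by norm_num),
    eval_X, eval_X] at hint
  field_simp
  linarith

theorem legendrePoly_eq_C_mul_nodal {n : ℕ} {x : Fin n → ℝ} (hinj : Function.Injective x)
    (hroot : ∀ i, (legendrePoly n).eval (x i) = 0) :
    legendrePoly n = C ((legendrePoly n).coeff n) * Lagrange.nodal Finset.univ x := by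
  have hnd : (Lagrange.nodal Finset.univ x).natDegree = n := by simp
  have hc : (legendrePoly n).coeff n ≠ 0 := by rw [legendrePoly_coeff_self]; positivity
  refine Polynomial.eq_of_degree_sub_lt_of_eval_index_eq (v := x) Finset.univ hinj.injOn ?_ ?_
  · rw [degree_lt_iff_coeff_zero]
    intro k hk
    rw [Finset.card_univ, Fintype.card_fin] at hk
    rw [coeff_sub, coeff_C_mul]
    rcases hk.eq_or_lt with rfl | hlt
    · have := (Lagrange.nodal_monic (s := Finset.univ) (v := x)).coeff_natDegree
      rw [hnd] at this
      rw [this]; ring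
    · rw [coeff_eq_zero_of_natDegree_lt (by rwa [legendrePoly_natDegree]),
        coeff_eq_zero_of_natDegree_lt (p := Lagrange.nodal Finset.univ x) (by rwa [hnd])]
      ring
  · intro i hi
    rw [hroot, eval_mul, Lagrange.eval_nodal_at_node hi, mul_zero]

theorem integral_nodal_sq {n : ℕ} {x : Fin n → ℝ} (hinj : Function.Injective x)
    (hroot : ∀ i, (legendrePoly n).eval (x i) = 0) :
    ∫ y in (-1 : ℝ)..1, (Lagrange.nodal Finset.univ x ^ 2).eval y
      = 2 ^ (2 * n + 1) * (n.factorial : ℝ) ^ 4 / ((2 * n + 1) * ((2 * n).factorial : ℝ) ^ 2) := by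
  have h := integral_legendrePoly_sq n
  rw [legendrePoly_eq_C_mul_nodal hinj hroot, mul_pow, ← C_pow, integral_eval_C_mul,
    legendrePoly_coeff_self] at h
  have h1 : (n.factorial : ℝ) ≠ 0 := by positivity
  have h2 : ((2 * n).factorial : ℝ) ≠ 0 := by positivity
  field_simp at h ⊢
  rw [h]
  ring

theorem integral_eval_eq_sum_of_degree_lt {n : ℕ} {x : Fin n → ℝ} (hinj : Function.Injective x)
    {p : ℝ[X]} (hp : p.degree < n) (a b : ℝ) :
    ∫ y in a..b, p.eval y
      = ∑ i, (∫ y in a..b, (Lagrange.basis Finset.univ x i).eval y) * p.eval (x i) := by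
  have h := Lagrange.eq_interpolate (s := Finset.univ) hinj.injOn
    (show p.degree < (Finset.univ : Finset (Fin n)).card by simpa using hp)
  conv_lhs => rw [h]
  simp only [Lagrange.interpolate_apply, eval_finsetSum]
  rw [intervalIntegral.integral_finsetSum fun i _ => intervalIntegrable_eval _ _ _]
  refine Finset.sum_congr rfl fun i _ => ?_
  rw [integral_eval_C_mul, mul_comm]

/-- Gauss quadrature is exact for polynomials of degree less than `2n`. -/
theorem integral_eval_eq_sum_of_degree_lt_two_mul {n : ℕ} {x : Fin n → ℝ}
    (hinj : Function.Injective x) (hroot : ∀ i, (legendrePoly n).eval (x i) = 0)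
    {p : ℝ[X]} (hp : p.degree < (2 * n : ℕ)) :
    ∫ y in (-1 : ℝ)..1, p.eval y
      = ∑ i, (∫ y in (-1 : ℝ)..1, (Lagrange.basis Finset.univ x i).eval y) * p.eval (x i) := by
  set ω := Lagrange.nodal Finset.univ x with hω
  have hmonic : ω.Monic := Lagrange.nodal_monic
  have hdω : ω.degree = n := by simp [hω]
  have hc : (legendrePoly n).coeff n ≠ 0 := by rw [legendrePoly_coeff_self]; positivity
  have hdiv := modByMonic_add_div p ω
  have hmod : (p %ₘ ω).degree < n := hdω ▸ degree_modByMonic_lt p hmonic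
  have hquot : (p /ₘ ω).degree < n := by
    by_contra! hcon
    have hle : ω.degree ≤ p.degree := by
      by_contra! hlt
      rw [(divByMonic_eq_zero_iff hmonic).2 hlt, degree_zero] at hcon
      simp at hcon
    have h := degree_add_divByMonic hmonic hle
    rw [← h, hdω] at hp
    have h2 : ((n : WithBot ℕ) + n) ≤ n + (p /ₘ ω).degree := by gcongr
    have h3 := h2.trans_lt hp
    rw [two_mul] at h3
    exact lt_irrefl _ (by exact_mod_cast h3)
  have horth : ∫ y in (-1 : ℝ)..1, (ω * (p /ₘ ω)).eval y = 0 := by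
    have h := integral_legendrePoly_mul_eq_zero (p /ₘ ω) hquot
    rw [legendrePoly_eq_C_mul_nodal hinj hroot, mul_assoc, integral_eval_C_mul] at h
    exact (mul_eq_zero.1 h).resolve_left hc
  conv_lhs => rw [← hdiv]
  rw [integral_eval_add, horth, add_zero, integral_eval_eq_sum_of_degree_lt hinj hmod]
  refine Finset.sum_congr rfl fun i hi => ?_
  congr 1
  conv_rhs => rw [← hdiv]
  rw [eval_add, eval_mul, hω, Lagrange.eval_nodal_at_node hi, zero_mul, add_zero]

theorem integral_lagrange_basis_eq {n : ℕ} {x : Fin n → ℝ}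
    (hmem : ∀ i, x i ∈ Ioo (-1 : ℝ) 1)
    (hinj : Function.Injective x) (hroot : ∀ i, (legendrePoly n).eval (x i) = 0) (i : Fin n) :
    ∫ y in (-1 : ℝ)..1, (Lagrange.basis Finset.univ x i).eval y
      = 2 / ((1 - x i ^ 2) * (derivative (legendrePoly n)).eval (x i) ^ 2) := by
  have hn : 0 < n := i.pos
  obtain ⟨q, hq⟩ := dvd_iff_isRoot.2 (hroot i)
  have hP0 : legendrePoly n ≠ 0 := by
    intro h
    simpa [h] using legendrePoly_degree n
  have hq0 : q ≠ 0 := by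
    rintro rfl
    exact hP0 (by rw [hq, mul_zero])
  have hqn : q.natDegree < n := by
    have h := legendrePoly_natDegree n
    rw [hq, natDegree_mul (X_sub_C_ne_zero _) hq0, natDegree_X_sub_C] at h
    omega
  have hqx : ∀ j, j ≠ i → q.eval (x j) = 0 := by
    intro j hj
    have h := hroot j
    rw [hq, eval_mul, eval_sub, eval_X, eval_C] at h
    exact (mul_eq_zero.1 h).resolve_left (sub_ne_zero.2 (hinj.ne hj))
  have hder : derivative (legendrePoly n) = q + (X - C (x i)) * derivative q := by
    rw [hq, derivative_mul, derivative_X_sub_C, one_mul]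
  have hderx : (derivative (legendrePoly n)).eval (x i) = q.eval (x i) := by simp [hder]
  have hqi : q.eval (x i) ≠ 0 := by
    intro h
    refine hq0 (Polynomial.eq_zero_of_degree_lt_of_eval_index_eq_zero (v := x) Finset.univ
      hinj.injOn ?_ ?_)
    · rw [Finset.card_univ, Fintype.card_fin]
      exact (natDegree_lt_iff_degree_lt hq0).1 hqn
    · intro j _
      by_cases hj : j = i
      · rw [hj, h]
      · exact hqx j hj
  have hquad : ∀ g : ℝ[X], g.natDegree < n → ∫ y in (-1 : ℝ)..1, (q * g).eval y
      = (∫ y in (-1 : ℝ)..1, (Lagrange.basis Finset.univ x i).eval y)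
        * (q.eval (x i) * g.eval (x i)) := by
    intro g hg
    rw [integral_eval_eq_sum_of_degree_lt_two_mul hinj hroot, Finset.sum_eq_single i]
    · rw [eval_mul]
    · intro j _ hj
      rw [eval_mul, hqx j hj, zero_mul, mul_zero]
    · simp
    · refine degree_le_natDegree.trans_lt ?_
      have := natDegree_mul_le (p := q) (q := g)
      exact_mod_cast (by omega : (q * g).natDegree < 2 * n)
  have h1 := hquad q hqn
  have h2 := hquad (derivative (legendrePoly n)) (by
    have := natDegree_derivative_le (legendrePoly n)
    rw [legendrePoly_natDegree] at this
    omega)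
  have hid : C 2 * (q * derivative (legendrePoly n))
      = q * q + derivative ((X - C (x i)) * q ^ 2) := by
    rw [hder, derivative_mul, derivative_X_sub_C, derivative_pow]
    simp only [map_ofNat, Nat.cast_ofNat]
    ring
  have h3 := integral_eval_C_mul 2 (q * derivative (legendrePoly n)) (-1) 1
  have hsq : ∀ r : ℝ, r ^ 2 = 1 → ((r - x i) * q.eval r) ^ 2 = 1 := by
    intro r hr
    have := legendrePoly_eval_sq hr n
    rwa [hq, eval_mul, eval_sub, eval_X, eval_C] at this
  rw [hid, integral_eval_add, integral_eval_derivative, h1, h2, hderx] at h3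
  simp only [eval_mul, eval_sub, eval_X, eval_C, eval_pow] at h3
  have hp1 := hsq 1 (by norm_num)
  have hm1 := hsq (-1) (by norm_num)
  obtain ⟨hl, hu⟩ := hmem i
  have hpos1 : 0 < 1 - x i := by linarith
  have hpos2 : 0 < 1 + x i := by linarith
  have hne : 1 - x i ^ 2 ≠ 0 := by nlinarith
  rw [hderx, eq_div_iff (by positivity)]
  linear_combination (-(1 - x i ^ 2)) * h3 + (1 + x i) * hp1 + (1 - x i) * hm1

/-- Rolle's theorem for finitely many zeros: the zeros of the derivative lie strictly between
consecutive zeros of the function. -/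
theorem exists_finset_deriv_eq_zero {g : ℝ → ℝ} {a b : ℝ} (hg : ContinuousOn g (Ioo a b))
    {s : Finset ℝ} {m : ℕ} (hcard : s.card = m + 1) (hs : ∀ y ∈ s, y ∈ Ioo a b ∧ g y = 0) :
    ∃ s' : Finset ℝ, s'.card = m ∧ Disjoint s' s ∧ ∀ y ∈ s', y ∈ Ioo a b ∧ deriv g y = 0 := by
  set e := s.orderEmbOfFin hcard with he
  have hes : ∀ j, e j ∈ s := s.orderEmbOfFin_mem hcard
  have hrolle : ∀ j : Fin m, ∃ c ∈ Ioo (e j.castSucc) (e j.succ), deriv g c = 0 := by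
    intro j
    refine exists_deriv_eq_zero (e.strictMono j.castSucc_lt_succ) (hg.mono ?_) ?_
    · exact Icc_subset_Ioo (hs _ (hes _)).1.1 (hs _ (hes _)).1.2
    · rw [(hs _ (hes _)).2, (hs _ (hes _)).2]
  choose c hc hc0 using hrolle
  have hcmono : StrictMono c := by
    intro j l hjl
    refine (hc j).2.trans_le (le_trans ?_ (hc l).1.le)
    exact e.monotone (Fin.succ_le_castSucc_iff.2 hjl)
  refine ⟨Finset.univ.map ⟨c, hcmono.injective⟩, by simp, ?_, ?_⟩
  · rw [Finset.disjoint_left]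
    intro y hy hys
    obtain ⟨j, -, rfl⟩ := Finset.mem_map.1 hy
    have hr : c j ∈ Set.range e := by
      rw [he, Finset.range_orderEmbOfFin]
      exact hys
    obtain ⟨l, hl⟩ := hr
    have h1 : e j.castSucc < e l := hl ▸ (hc j).1
    have h2 : e l < e j.succ := hl ▸ (hc j).2
    rw [e.lt_iff_lt, Fin.lt_def] at h1 h2
    simp only [Fin.val_castSucc, Fin.val_succ] at h1 h2
    omega
  · intro y hy
    obtain ⟨j, -, rfl⟩ := Finset.mem_map.1 hy
    exact ⟨⟨(hs _ (hes _)).1.1.trans (hc j).1, (hc j).2.trans (hs _ (hes _)).1.2⟩, hc0 j⟩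

theorem continuousOn_iteratedDeriv_Ioo {g : ℝ → ℝ} {a b : ℝ} {N : ℕ}
    (hg : ContDiffOn ℝ N g (Ioo a b)) {m : ℕ} (hm : m ≤ N) :
    ContinuousOn (iteratedDeriv m g) (Ioo a b) :=
  (hg.continuousOn_iteratedDerivWithin (by exact_mod_cast hm) isOpen_Ioo.uniqueDiffOn).congr
    fun _ hy => (iteratedDerivWithin_of_isOpen isOpen_Ioo hy).symm

/-- If the `j`-th derivative has `m + 1` zeros, then the `(j + m)`-th derivative has a zero. -/
theorem exists_iteratedDeriv_eq_zero {g : ℝ → ℝ} {a b : ℝ} {N : ℕ}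
    (hg : ContDiffOn ℝ N g (Ioo a b)) {j m : ℕ} (hjm : j + m ≤ N) {s : Finset ℝ}
    (hcard : s.card = m + 1) (hs : ∀ y ∈ s, y ∈ Ioo a b ∧ iteratedDeriv j g y = 0) :
    ∃ ξ ∈ Ioo a b, iteratedDeriv (j + m) g ξ = 0 := by
  induction m generalizing j s with
  | zero =>
    obtain ⟨y, hy⟩ : s.Nonempty := Finset.card_pos.1 (by omega)
    exact ⟨y, hs y hy⟩
  | succ m ih =>
    obtain ⟨s', hcard', -, hs'⟩ := exists_finset_deriv_eq_zero
      (continuousOn_iteratedDeriv_Ioo hg (by omega)) hcard hs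
    rw [show j + (m + 1) = j + 1 + m by ring]
    refine ih (by omega) hcard' fun y hy => ?_
    rw [iteratedDeriv_succ]
    exact hs' y hy

/-- A function with `n` double zeros and one further zero has a zero of its `2n`-th derivative. -/
theorem exists_iteratedDeriv_two_mul_eq_zero {g : ℝ → ℝ} {a b : ℝ} {n : ℕ} (hn : 1 ≤ n)
    (hg : ContDiffOn ℝ (2 * n : ℕ) g (Ioo a b)) {t : Fin n → ℝ} (ht : Function.Injective t)
    (hmem : ∀ i, t i ∈ Ioo a b) (h0 : ∀ i, g (t i) = 0) (h1 : ∀ i, deriv g (t i) = 0)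
    {u : ℝ} (hu : u ∈ Ioo a b) (hut : ∀ i, u ≠ t i) (hgu : g u = 0) :
    ∃ ξ ∈ Ioo a b, iteratedDeriv (2 * n) g ξ = 0 := by
  set s : Finset ℝ := Finset.univ.map ⟨t, ht⟩ with hs
  have hst : ∀ y ∈ s, ∃ i, t i = y := by simp [hs]
  have hscard : s.card = n := by simp [hs]
  have hus : u ∉ s := fun h => let ⟨i, hi⟩ := hst u h; hut i hi.symm
  obtain ⟨s', hcard', hdisj, hs'⟩ := exists_finset_deriv_eq_zero hg.continuousOn
    (s := insert u s) (m := n) (by rw [Finset.card_insert_of_notMem hus, hscard]) (by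
      intro y hy
      rcases Finset.mem_insert.1 hy with rfl | hy
      · exact ⟨hu, hgu⟩
      · obtain ⟨i, rfl⟩ := hst y hy
        exact ⟨hmem i, h0 i⟩)
  have hdisj' : Disjoint s' s := hdisj.mono_right (Finset.subset_insert _ _)
  have hfinal := exists_iteratedDeriv_eq_zero hg (j := 1) (m := 2 * n - 1) (by omega)
    (s := s' ∪ s) (by rw [Finset.card_union_of_disjoint hdisj', hcard', hscard]; omega) (by
      intro y hy
      rw [iteratedDeriv_one]
      rcases Finset.mem_union.1 hy with hy | hy
      · exact hs' y hy
      · obtain ⟨i, rfl⟩ := hst y hy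
        exact ⟨hmem i, h1 i⟩)
  rwa [show 1 + (2 * n - 1) = 2 * n by omega] at hfinal

theorem eval_derivative_nodal_ne_zero {n : ℕ} {t : Fin n → ℝ} (ht : Function.Injective t)
    (i : Fin n) : (derivative (Lagrange.nodal Finset.univ t)).eval (t i) ≠ 0 := by
  rw [Lagrange.eval_nodal_derivative_eval_node_eq (Finset.mem_univ i), Lagrange.eval_nodal]
  refine Finset.prod_ne_zero_iff.2 fun j hj => sub_ne_zero.2 ?_
  exact ht.ne (Finset.ne_of_mem_erase hj).symm

/-- Hermite interpolation with prescribed values and first derivatives. -/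
theorem exists_hermite_interpolation {n : ℕ} {t : Fin n → ℝ} (ht : Function.Injective t)
    (v d : Fin n → ℝ) :
    ∃ H : ℝ[X], H.degree < (2 * n : ℕ) ∧ (∀ i, H.eval (t i) = v i) ∧
      ∀ i, (derivative H).eval (t i) = d i := by
  have hdeg : ∀ r : Fin n → ℝ, (Lagrange.interpolate Finset.univ t r).degree < n := fun r => by
    simpa using Lagrange.degree_interpolate_lt (s := Finset.univ) r ht.injOn
  set ω := Lagrange.nodal Finset.univ t with hω
  have hωt : ∀ i, ω.eval (t i) = 0 := fun i => Lagrange.eval_nodal_at_node (Finset.mem_univ i)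
  set L := Lagrange.interpolate Finset.univ t v with hL
  set M := Lagrange.interpolate Finset.univ t
    (fun i => (d i - (derivative L).eval (t i)) / (derivative ω).eval (t i)) with hM
  refine ⟨L + ω * M, ?_, fun i => ?_, fun i => ?_⟩
  · refine (degree_add_le _ _).trans_lt (max_lt ((hdeg v).trans_le ?_) ?_)
    · exact_mod_cast (by omega : n ≤ 2 * n)
    · have hωd : ω.degree = n := by simp [hω]
      rw [degree_mul, hωd, two_mul, Nat.cast_add]
      exact WithBot.add_lt_add_left (by simp) (hdeg _)
  · rw [eval_add, eval_mul, hωt, zero_mul, add_zero, hL,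
      Lagrange.eval_interpolate_at_node v ht.injOn (Finset.mem_univ i)]
  · rw [derivative_add, derivative_mul, eval_add, eval_add, eval_mul, eval_mul, hωt, zero_mul,
      add_zero, hM, Lagrange.eval_interpolate_at_node _ ht.injOn (Finset.mem_univ i),
      mul_div_cancel₀ _ (eval_derivative_nodal_ne_zero ht i)]
    ring

/-- The pointwise error formula for Hermite interpolation. -/
theorem exists_hermite_error {f : ℝ → ℝ} {a b : ℝ} {n : ℕ} (hn : 1 ≤ n)
    (hf : ContDiffOn ℝ (2 * n : ℕ) f (Ioo a b)) {t : Fin n → ℝ} (ht : Function.Injective t)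
    (hmem : ∀ i, t i ∈ Ioo a b) {H : ℝ[X]} (hH : H.degree < (2 * n : ℕ))
    (h0 : ∀ i, H.eval (t i) = f (t i)) (h1 : ∀ i, (derivative H).eval (t i) = deriv f (t i))
    {u : ℝ} (hu : u ∈ Ioo a b) (hut : ∀ i, u ≠ t i) :
    ∃ ξ ∈ Ioo a b, f u - H.eval u = iteratedDeriv (2 * n) f ξ / (2 * n).factorial
      * ((Lagrange.nodal Finset.univ t) ^ 2).eval u := by
  set ω := Lagrange.nodal Finset.univ t with hω
  have hωt : ∀ i, ω.eval (t i) = 0 := fun i => Lagrange.eval_nodal_at_node (Finset.mem_univ i)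
  have hωu : (ω ^ 2).eval u ≠ 0 := by
    rw [eval_pow]
    exact pow_ne_zero 2 (Lagrange.eval_nodal_not_at_node fun i _ => hut i)
  set l := (f u - H.eval u) / (ω ^ 2).eval u with hl
  set p := H + C l * ω ^ 2 with hp
  have hpd : ContDiff ℝ (2 * n : ℕ) fun z => p.eval z := by
    simpa [aeval_def] using p.contDiff_aeval (𝕜 := ℝ) (2 * n : ℕ)
  have hfat : ∀ y ∈ Ioo a b, ContDiffAt ℝ (2 * n : ℕ) f y := fun y hy =>
    hf.contDiffAt (isOpen_Ioo.mem_nhds hy)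
  have hpat : ∀ y, ContDiffAt ℝ (2 * n : ℕ) (fun z => p.eval z) y := fun y =>
    hpd.contDiffAt
  obtain ⟨ξ, hξ, hξ0⟩ := exists_iteratedDeriv_two_mul_eq_zero (g := f - fun z => p.eval z) hn
    (hf.sub hpd.contDiffOn) ht hmem (fun i => by simp [hp, hωt, h0])
    (fun i => by
      have hd : DifferentiableAt ℝ f (t i) :=
        (hfat _ (hmem i)).differentiableAt (by norm_cast; omega)
      rw [deriv_sub hd p.differentiableAt, Polynomial.deriv, ← h1 i]
      simp [hp, hωt, derivative_pow]) hu hut (by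
      simp only [Pi.sub_apply, hp, eval_add, eval_mul, eval_C, hl]
      rw [div_mul_cancel₀ _ hωu]
      ring)
  refine ⟨ξ, hξ, ?_⟩
  have hcoeff : derivative^[2 * n] (ω ^ 2) = C ((2 * n).factorial : ℝ) := by
    have hmon : (ω ^ 2).Monic := (Lagrange.nodal_monic (s := Finset.univ) (v := t)).pow 2
    have hnd : (ω ^ 2).natDegree = 2 * n := by
      rw [(Lagrange.nodal_monic (s := Finset.univ) (v := t)).natDegree_pow]
      simp
    have hlead := hmon.coeff_natDegree
    rw [hnd] at hlead
    ext k
    rw [coeff_iterate_derivative, coeff_C]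
    split_ifs with hk
    · simp [hk, hlead, Nat.descFactorial_self]
    · rw [coeff_eq_zero_of_natDegree_lt (by omega), smul_zero]
  rw [iteratedDeriv_sub (hfat ξ hξ) (hpat ξ), iteratedDeriv_polynomial_eval, hp,
    iterate_map_add, iterate_derivative_eq_zero_of_degree_lt hH, iterate_derivative_C_mul,
    hcoeff] at hξ0
  have hfac : ((2 * n).factorial : ℝ) ≠ 0 := by positivity
  have hl2 : iteratedDeriv (2 * n) f ξ / (2 * n).factorial = l := by
    rw [div_eq_iff hfac]
    simpa [sub_eq_zero] using hξ0
  rw [hl2, hl, div_mul_cancel₀ _ hωu]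

theorem integral_pos_of_pos_off_finite {g : ℝ → ℝ} {a b : ℝ} (hab : a < b)
    (hg : ContinuousOn g (Icc a b)) {s : Set ℝ} (hs : s.Finite)
    (hpos : ∀ y ∈ Ioo a b, y ∉ s → 0 < g y) : 0 < ∫ y in a..b, g y := by
  have hclosure : Icc a b ⊆ closure (Ioo a b \ s) := by
    rw [← closure_Ioo hab.ne]
    refine closure_minimal (fun y hy => ?_) isClosed_closure
    exact (hs.countable.dense_compl ℝ).open_subset_closure_inter isOpen_Ioo hy
  have hcont : ContinuousOn g (closure (Ioo a b \ s)) :=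
    hg.mono (closure_minimal (sdiff_subset.trans Ioo_subset_Icc_self) isClosed_Icc)
  have hnonneg : ∀ y ∈ Icc a b, 0 ≤ g y := fun y hy =>
    le_on_closure (fun z hz => (hpos z hz.1 hz.2).le) continuousOn_const hcont (hclosure hy)
  have hinf : (Ioo a b \ s).Nonempty := ((Ioo_infinite hab).sdiff hs).nonempty
  obtain ⟨c, hc, hcs⟩ := hinf
  exact intervalIntegral.integral_pos hab hg (fun y hy => hnonneg y (Ioc_subset_Icc_self hy))
    ⟨c, Ioo_subset_Icc_self hc, hpos c hc hcs⟩

/-- Change of variables from `[a, b]` to `[-1, 1]`. -/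
theorem integral_eval_eq_integral_comp_affine (p : ℝ[X]) (a b : ℝ) :
    ∫ y in a..b, p.eval y = (b - a) / 2 *
      ∫ s in (-1 : ℝ)..1, (p.comp (C ((b - a) / 2) * X + C ((b + a) / 2))).eval s := by
  have h := intervalIntegral.mul_integral_comp_mul_add (f := fun y => p.eval y) (a := -1) (b := 1)
    ((b - a) / 2) ((b + a) / 2)
  simp only [eval_comp, eval_add, eval_mul, eval_C, eval_X]
  rw [h]
  congr 1 <;> ring

theorem integral_eval_eq_gauss_quadrature {n : ℕ} {a b : ℝ} (hab : a < b) {x : Fin n → ℝ}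
    (hmem : ∀ i, x i ∈ Ioo (-1 : ℝ) 1) (hinj : Function.Injective x)
    (hroot : ∀ i, (legendrePoly n).eval (x i) = 0) {p : ℝ[X]} (hp : p.degree < (2 * n : ℕ)) :
    ∫ y in a..b, p.eval y = (b - a) / 2 *
      ∑ i, 2 / ((1 - x i ^ 2) * (derivative (legendrePoly n)).eval (x i) ^ 2)
        * p.eval ((b + a + (b - a) * x i) / 2) := by
  have hdeg : (p.comp (C ((b - a) / 2) * X + C ((b + a) / 2))).degree < (2 * n : ℕ) := by
    have hne : (b - a) / 2 ≠ 0 := by linarith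
    rcases eq_or_ne p 0 with rfl | hp0
    · simpa using hp
    · refine degree_le_natDegree.trans_lt ?_
      rw [natDegree_comp, natDegree_linear hne, mul_one]
      exact_mod_cast (natDegree_lt_iff_degree_lt hp0).2 hp
  rw [integral_eval_eq_integral_comp_affine p a b,
    integral_eval_eq_sum_of_degree_lt_two_mul hinj hroot hdeg]
  congr 1
  refine Finset.sum_congr rfl fun i _ => ?_
  rw [integral_lagrange_basis_eq hmem hinj hroot]
  simp only [eval_comp, eval_add, eval_mul, eval_C, eval_X]
  congr 2
  ring

theorem integral_nodal_affine_sq {n : ℕ} (a b : ℝ) {x : Fin n → ℝ}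
    (hinj : Function.Injective x) (hroot : ∀ i, (legendrePoly n).eval (x i) = 0) :
    ∫ y in a..b,
        (Lagrange.nodal Finset.univ (fun i => (b + a + (b - a) * x i) / 2) ^ 2).eval y
      = (b - a) ^ (2 * n + 1) * (n.factorial : ℝ) ^ 4
        / ((2 * n + 1) * ((2 * n).factorial : ℝ) ^ 2) := by
  have hcomp : (Lagrange.nodal Finset.univ (fun i => (b + a + (b - a) * x i) / 2) ^ 2).comp
      (C ((b - a) / 2) * X + C ((b + a) / 2))
      = C (((b - a) / 2) ^ (2 * n)) * Lagrange.nodal Finset.univ x ^ 2 := by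
    refine Polynomial.funext fun s => ?_
    simp only [eval_comp, eval_add, eval_mul, eval_C, eval_X, eval_pow, Lagrange.eval_nodal]
    have h : ∀ i : Fin n, (b - a) / 2 * s + (b + a) / 2 - (b + a + (b - a) * x i) / 2
        = (b - a) / 2 * (s - x i) := fun i => by ring
    simp only [h, Finset.prod_mul_distrib, Finset.prod_const, Finset.card_univ, Fintype.card_fin]
    ring
  rw [integral_eval_eq_integral_comp_affine _ a b, hcomp, integral_eval_C_mul,
    integral_nodal_sq hinj hroot, div_pow]
  field_simp
  ring

/-- The integrated error formula for Hermite interpolation. -/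
theorem exists_integral_eq_hermite_error {f : ℝ → ℝ} {a b : ℝ} (hab : a < b) {n : ℕ} (hn : 1 ≤ n)
    (hf : ContDiffOn ℝ (2 * n : ℕ) f (Icc a b)) {t : Fin n → ℝ} (ht : Function.Injective t)
    (hmem : ∀ i, t i ∈ Ioo a b) {H : ℝ[X]} (hH : H.degree < (2 * n : ℕ))
    (h0 : ∀ i, H.eval (t i) = f (t i)) (h1 : ∀ i, (derivative H).eval (t i) = deriv f (t i)) :
    ∃ ξ ∈ Ioo a b, ∫ y in a..b, f y = (∫ y in a..b, H.eval y)
      + iteratedDeriv (2 * n) f ξ / (2 * n).factorial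
        * ∫ y in a..b, (Lagrange.nodal Finset.univ t ^ 2).eval y := by
  set ω := Lagrange.nodal Finset.univ t with hω
  have hfo : ContDiffOn ℝ (2 * n : ℕ) f (Ioo a b) := hf.mono Ioo_subset_Icc_self
  have hfac : (0 : ℝ) < (2 * n).factorial := by positivity
  have hωpos : ∀ u, (∀ i, u ≠ t i) → 0 < (ω ^ 2).eval u := fun u hut => by
    rw [eval_pow]
    exact sq_pos_of_ne_zero (Lagrange.eval_nodal_not_at_node fun i _ => hut i)
  have hfin : (range t).Finite := finite_range t
  have hnode : ∀ u, u ∉ range t → ∀ i, u ≠ t i := fun u hu i hi => hu ⟨i, hi.symm⟩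
  set K := ∫ y in a..b, (ω ^ 2).eval y with hK
  have hKpos : 0 < K := integral_pos_of_pos_off_finite hab (ω ^ 2).continuousOn hfin
    fun u _ hu => hωpos u (hnode u hu)
  set E := (∫ y in a..b, f y) - ∫ y in a..b, H.eval y with hE
  set c := E * (2 * n).factorial / K with hc
  suffices hex : ∃ ξ ∈ Ioo a b, iteratedDeriv (2 * n) f ξ = c by
    obtain ⟨ξ, hξ, hξc⟩ := hex
    refine ⟨ξ, hξ, ?_⟩
    rw [hξc, hc]
    field_simp
    rw [hE]
    ring
  by_contra! hne
  set G : ℝ → ℝ := fun y => f y - H.eval y - c / (2 * n).factorial * (ω ^ 2).eval y with hG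
  have hGc : ContinuousOn G (Icc a b) :=
    (hf.continuousOn.sub H.continuousOn).sub (continuousOn_const.mul (ω ^ 2).continuousOn)
  have hGint : ∫ y in a..b, G y = 0 := by
    have hfi : IntervalIntegrable f MeasureTheory.volume a b :=
      hf.continuousOn.intervalIntegrable_of_Icc hab.le
    rw [hG, intervalIntegral.integral_sub (hfi.sub (intervalIntegrable_eval _ _ _))
      ((intervalIntegrable_eval _ _ _).const_mul _),
      intervalIntegral.integral_sub hfi (intervalIntegrable_eval _ _ _),
      intervalIntegral.integral_const_mul, ← hE, ← hK, hc]
    field_simp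
    ring
  have hGerr : ∀ u ∈ Ioo a b, u ∉ range t → ∃ ξ ∈ Ioo a b,
      G u = (iteratedDeriv (2 * n) f ξ - c) * ((ω ^ 2).eval u / (2 * n).factorial) := by
    intro u hu hut
    obtain ⟨ξ, hξ, h⟩ := exists_hermite_error hn hfo ht hmem hH h0 h1 hu (hnode u hut)
    refine ⟨ξ, hξ, ?_⟩
    simp only [hG]
    rw [h]
    ring
  have hquot : ∀ u, u ∉ range t → 0 < (ω ^ 2).eval u / (2 * n).factorial := fun u hu =>
    div_pos (hωpos u (hnode u hu)) hfac
  have himage : (iteratedDeriv (2 * n) f '' Ioo a b).OrdConnected :=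
    (isPreconnected_Ioo.image _ (continuousOn_iteratedDeriv_Ioo hfo le_rfl)).ordConnected
  have hsign : (∀ y ∈ Ioo a b, c < iteratedDeriv (2 * n) f y) ∨
      ∀ y ∈ Ioo a b, iteratedDeriv (2 * n) f y < c := by
    by_contra! hcon
    obtain ⟨⟨y, hy, hyc⟩, z, hz, hzc⟩ := hcon
    obtain ⟨ξ, hξ, h⟩ := himage.out (mem_image_of_mem _ hy) (mem_image_of_mem _ hz) ⟨hyc, hzc⟩
    exact hne ξ hξ h
  rcases hsign with hlt | hgt
  · refine (integral_pos_of_pos_off_finite hab hGc hfin fun u hu hut => ?_).ne' hGint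
    obtain ⟨ξ, hξ, h⟩ := hGerr u hu hut
    rw [h]
    exact mul_pos (sub_pos.2 (hlt ξ hξ)) (hquot u hut)
  · refine (integral_pos_of_pos_off_finite hab hGc.neg hfin fun u hu hut => ?_).ne' ?_
    · obtain ⟨ξ, hξ, h⟩ := hGerr u hu hut
      rw [Pi.neg_apply, h, ← neg_mul]
      exact mul_pos (by linarith [hgt ξ hξ]) (hquot u hut)
    · simp only [Pi.neg_apply]
      rw [intervalIntegral.integral_neg, hGint, neg_zero]

theorem extended_gauss_legendre_formula (n : ℕ) (hn : 1 ≤ n) (a b : ℝ) (hab : a < b)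
    (k : ℝ) (x : Fin n → ℝ)
    (hmem : ∀ i, x i ∈ Set.Ioo (-1:ℝ) 1)
    (hroot : ∀ i, legendre n (x i) = 0)
    (hinj : Function.Injective x)
    (w : Fin n → ℝ)
    (hw : ∀ i, w i = 2 / ((1 - (x i)^2) * (deriv (legendre n) (x i))^2))
    (f : ℝ × ℝ → ℝ)
    (hf : ContDiffOn ℝ (2*n) (fun t => f (t, k)) (Set.Icc a b)) :
    ∃ ξ ∈ Set.Ioo a b,
      ∫ t in a..b, f (t, k)
        = ((b - a)/2) * ∑ i, w i * f ((b + a + (b - a) * x i)/2, k)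
          + ((Nat.factorial n : ℝ)^4 / (Nat.factorial (2*n) : ℝ)^3)
            * ((b - a)^(2*n+1) / (2*(n:ℝ)+1))
            * iteratedDeriv (2*n) (fun t => f (t, k)) ξ := by
  have hroot' : ∀ i, (legendrePoly n).eval (x i) = 0 := fun i => by
    rw [← hroot i, legendre_eq_eval]
  have hderiv : ∀ i, deriv (legendre n) (x i) = (derivative (legendrePoly n)).eval (x i) :=
    fun i => by rw [legendre_eq_eval, Polynomial.deriv]
  set t : Fin n → ℝ := fun i => (b + a + (b - a) * x i) / 2 with ht
  have hba : 0 < b - a := sub_pos.2 hab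
  have htinj : Function.Injective t := fun i j hij => by
    simp only [ht] at hij
    exact hinj (mul_left_cancel₀ hba.ne' (by linarith))
  have htmem : ∀ i, t i ∈ Ioo a b := fun i => by
    obtain ⟨hl, hu⟩ := hmem i
    constructor <;> simp only [ht] <;> nlinarith
  obtain ⟨H, hH, hHv, hHd⟩ := exists_hermite_interpolation htinj (fun i => f (t i, k))
    (fun i => deriv (fun s => f (s, k)) (t i))
  obtain ⟨ξ, hξ, h⟩ := exists_integral_eq_hermite_error hab hn (f := fun s => f (s, k))
    (by exact_mod_cast hf) htinj htmem hH hHv hHd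
  refine ⟨ξ, hξ, ?_⟩
  rw [h, integral_eval_eq_gauss_quadrature hab hmem hinj hroot' hH,
    integral_nodal_affine_sq a b hinj hroot']
  congr 1
  · congr 1
    refine Finset.sum_congr rfl fun i _ => ?_
    rw [hw, hderiv]
    exact congrArg _ (hHv i)
  · field_simp
end
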